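/- For every n ∈ ℕ and k ∈ ℕ there exists a countable abelian group G with a proper left invariant metric d such that asdim(G, d) = n but asdim_AN(G, d) = n + k. -/

import Mathlib

def ScaleChain {X : Type*} (d : X → X → ℝ) (s : ℝ) (U : Set X) (x y : X) : Prop :=
  ∃ (m : ℕ) (c : ℕ → X), c 0 = x ∧ c m = y ∧ (∀ i ≤ m, c i ∈ U) ∧
    ∀ i < m, d (c i) (c (i + 1)) < s

def IsControlFun {X : Type*} (d : X → X → ℝ) (n : ℕ) (D : ℝ → ℝ) : Prop :=
  ∀ s : ℝ, 0 < s → ∃ U : Fin (n + 1) → Set X,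
    (∀ x, ∃ i, x ∈ U i) ∧ ∀ i x y, ScaleChain d s (U i) x y → d x y ≤ D s

/-- Asymptotic Assouad-Nagata dimension at most `n`. -/
def ANdimLE {X : Type*} (d : X → X → ℝ) (n : ℕ) : Prop :=
  ∃ C : ℝ, 0 < C ∧ ∃ b : ℝ, IsControlFun d n (fun s => C * s + b)

/-- Asymptotic dimension at most `n`. -/
def AsdimLE {X : Type*} (d : X → X → ℝ) (n : ℕ) : Prop :=
  ∃ D : ℝ → ℝ, IsControlFun d n D

/-- `d` is a proper left invariant metric on the group `G`. -/
def IsPLIMetric {G : Type*} [Group G] (d : G → G → ℝ) : Prop :=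
  (∀ x y : G, d x y = 0 ↔ x = y) ∧ (∀ x y : G, d x y = d y x) ∧
    (∀ x y z : G, d x z ≤ d x y + d y z) ∧
    (∀ g x y : G, d (g * x) (g * y) = d x y) ∧
    ∀ K : ℝ, {g : G | d 1 g ≤ K}.Finite

/-- A group is locally finite if every finitely generated subgroup is finite. -/
def LocallyFiniteGroup (G : Type*) [Group G] : Prop :=
  ∀ s : Finset G, ((Subgroup.closure (s : Set G) : Subgroup G) : Set G).Finite

/-- The coefficient, on the face spanned by the directions in `A` at the lattice point `x`, of the
cup product of the coboundaries of the functions `a j`, `j ∈ l`, with coefficients in `ZMod 2`. -/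
def cupCoeff {ι : Type*} [DecidableEq ι] (a : ι → (ι → ℕ) → ZMod 2) :
    List ι → Finset ι → (ι → ℕ) → ZMod 2
  | [], A, _ => if A = ∅ then 1 else 0
  | j :: l, A, x => ∑ i ∈ A, (a j (x + Pi.single i 1) + a j x) *
      cupCoeff a l (A.erase i) (x + Pi.single i 1)

theorem sum_sum_erase_comm {ι : Type*} [DecidableEq ι] (A : Finset ι) (g : ι → ι → ZMod 2) :
    ∑ i ∈ A, ∑ j ∈ A.erase i, g i j = ∑ i ∈ A, ∑ j ∈ A.erase i, g j i := by
  refine Finset.sum_comm' fun i j => ?_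
  simp only [Finset.mem_erase]
  tauto

theorem sum_sum_erase_eq_zero_of_symm {ι : Type*} [DecidableEq ι] (A : Finset ι)
    (g : ι → ι → ZMod 2) (hg : ∀ i j, g i j = g j i) :
    ∑ i ∈ A, ∑ j ∈ A.erase i, g i j = 0 := by
  rw [Finset.sum_sigma']
  refine Finset.sum_involution (fun p _ => ⟨p.2, p.1⟩) ?_ ?_ ?_ ?_
  · rintro ⟨i, j⟩ -
    simp only
    rw [hg j i, CharTwo.add_self_eq_zero]
  · rintro ⟨i, j⟩ h - heq
    simp only [Finset.mem_sigma, Finset.mem_erase] at h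
    simp only [Sigma.mk.injEq] at heq
    exact h.2.1 heq.1
  · rintro ⟨i, j⟩ h
    simp only [Finset.mem_sigma, Finset.mem_erase] at h ⊢
    tauto
  · rintro ⟨i, j⟩ -
    rfl

theorem cupCoeff_closed {ι : Type*} [DecidableEq ι] (a : ι → (ι → ℕ) → ZMod 2) (l : List ι)
    (A : Finset ι) (x : ι → ℕ) :
    ∑ i ∈ A, (cupCoeff a l (A.erase i) (x + Pi.single i 1) + cupCoeff a l (A.erase i) x) = 0 := by
  induction l generalizing A x with
  | nil => exact Finset.sum_eq_zero fun i _ => by simp only [cupCoeff, CharTwo.add_self_eq_zero]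
  | cons k l ih =>
    have h₁ := sum_sum_erase_eq_zero_of_symm A
      (fun i j => a k (x + Pi.single i 1 + Pi.single j 1) *
        cupCoeff a l ((A.erase i).erase j) (x + Pi.single i 1 + Pi.single j 1)) (fun i j => by
        simp only [add_right_comm x, Finset.erase_right_comm (a := i)])
    have h₂ : ∑ i ∈ A, ∑ j ∈ A.erase i, (a k (x + Pi.single i 1) *
        cupCoeff a l ((A.erase i).erase j) (x + Pi.single i 1 + Pi.single j 1) +
        a k (x + Pi.single i 1) *
        cupCoeff a l ((A.erase j).erase i) (x + Pi.single i 1)) = 0 := by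
      refine Finset.sum_eq_zero fun i _ => ?_
      have := ih (A.erase i) (x + Pi.single i 1)
      simp_rw [← mul_add, ← Finset.mul_sum, Finset.erase_right_comm (b := i)]
      rw [this, mul_zero]
    have h₃ : ∑ i ∈ A, ∑ j ∈ A.erase i,
        a k x * cupCoeff a l ((A.erase i).erase j) (x + Pi.single j 1) = 0 := by
      rw [← sum_sum_erase_eq_zero_of_symm A
        (fun i j => a k x * cupCoeff a l ((A.erase i).erase j) x)
        (fun i j => by rw [Finset.erase_right_comm])]
      refine Finset.sum_congr rfl fun i _ => ?_
      rw [← Finset.mul_sum, ← Finset.mul_sum, ← CharTwo.add_eq_zero.1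
        ((Finset.sum_add_distrib).symm.trans (ih (A.erase i) x))]
    have h₄ := sum_sum_erase_comm A (fun i j => a k (x + Pi.single i 1) *
      cupCoeff a l ((A.erase j).erase i) (x + Pi.single i 1))
    simp only [Finset.sum_add_distrib] at h₂
    simp only [cupCoeff, add_mul, Finset.sum_add_distrib]
    linear_combination h₁ + h₂ + h₃ - h₄

theorem cupCoeff_eq_zero_of_const {ι : Type*} [DecidableEq ι] (a : ι → (ι → ℕ) → ZMod 2)
    {j : ι} {v : ℕ} {κ : ZMod 2} (hκ : ∀ x : ι → ℕ, x j = v → a j x = κ) (l : List ι)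
    (hj : j ∈ l) (A : Finset ι) (hA : j ∉ A) (x : ι → ℕ) (hx : x j = v) :
    cupCoeff a l A x = 0 := by
  induction l generalizing A x with
  | nil => simp at hj
  | cons k l ih =>
    refine Finset.sum_eq_zero fun i hi => ?_
    have hij : j ≠ i := by rintro rfl; exact hA hi
    have hx' : (x + Pi.single i 1 : ι → ℕ) j = v := by simp [hij, hx]
    rcases List.mem_cons.1 hj with rfl | hj
    · rw [hκ _ hx, hκ _ hx', CharTwo.add_self_eq_zero, zero_mul]
    · rw [ih hj _ (fun h => hA (Finset.mem_of_mem_erase h)) _ hx', mul_zero]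

theorem exists_ne_of_cupCoeff_ne_zero {ι : Type*} [DecidableEq ι] (a : ι → (ι → ℕ) → ZMod 2)
    (l : List ι) (A : Finset ι) (x : ι → ℕ) (h : cupCoeff a l A x ≠ 0) (j : ι) (hj : j ∈ l) :
    ∃ y z : ι → ℕ, (∀ i, x i ≤ y i ∧ y i ≤ x i + if i ∈ A then 1 else 0) ∧
      (∀ i, x i ≤ z i ∧ z i ≤ x i + if i ∈ A then 1 else 0) ∧ a j y ≠ a j z := by
  induction l generalizing A x with
  | nil => simp at hj
  | cons k l ih =>
    obtain ⟨i, hi, hne⟩ := Finset.exists_ne_zero_of_sum_ne_zero h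
    rcases List.mem_cons.1 hj with rfl | hj
    · refine ⟨x + Pi.single i 1, x, fun t => ?_, fun t => by simp, fun h => ?_⟩
      · by_cases ht : t = i
        · subst ht; simp [hi]
        · simp [ht]
      · rw [h, CharTwo.add_self_eq_zero, zero_mul] at hne
        exact hne rfl
    · obtain ⟨y, z, hy, hz, hyz⟩ := ih _ _ (right_ne_zero_of_mul hne) hj
      have key : ∀ y : ι → ℕ, (∀ t, (x + Pi.single i 1 : ι → ℕ) t ≤ y t ∧
          y t ≤ (x + Pi.single i 1 : ι → ℕ) t + if t ∈ A.erase i then 1 else 0) →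
          ∀ t, x t ≤ y t ∧ y t ≤ x t + if t ∈ A then 1 else 0 := by
        intro y hy t
        have := hy t
        by_cases ht : t = i
        · subst ht; simp [hi] at this ⊢; omega
        · simpa [ht] using this
      exact ⟨y, z, key y hy, key z hz, hyz⟩

/-- The lattice points with coordinates in `[0, M)` in the directions `A`, and `M` elsewhere. -/
def latticeBox {ι : Type*} [Fintype ι] [DecidableEq ι] (M : ℕ) (A : Finset ι) :
    Finset (ι → ℕ) :=
  Fintype.piFinset fun i => if i ∈ A then Finset.range M else {M}

theorem sum_latticeBox_telescope {ι : Type*} [Fintype ι] [DecidableEq ι] (M : ℕ) (A : Finset ι)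
    {i : ι} (hi : i ∈ A) (g : (ι → ℕ) → ZMod 2) :
    ∑ x ∈ latticeBox M A, (g (x + Pi.single i 1) + g x) =
      ∑ y ∈ latticeBox M (A.erase i), (g y + g (Function.update y i 0)) := by
  have hbij : ∑ x ∈ latticeBox M A, (g (x + Pi.single i 1) + g x) =
      ∑ p ∈ latticeBox M (A.erase i) ×ˢ Finset.range M,
        (g (Function.update p.1 i (p.2 + 1)) - g (Function.update p.1 i p.2)) := by
    refine Finset.sum_nbij' (fun x => (Function.update x i M, x i))
      (fun p => Function.update p.1 i p.2) ?_ ?_ ?_ ?_ ?_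
    · intro x hx
      simp only [latticeBox, Fintype.mem_piFinset, Finset.mem_product] at hx ⊢
      refine ⟨fun t => ?_, by simpa [hi] using hx i⟩
      by_cases ht : t = i
      · subst ht; simp
      · simpa [ht] using hx t
    · rintro ⟨y, t⟩ hp
      simp only [latticeBox, Fintype.mem_piFinset, Finset.mem_product] at hp ⊢
      intro u
      by_cases hu : u = i
      · subst hu; simpa [hi] using hp.2
      · simpa [hu] using hp.1 u
    · intro x _
      simp
    · rintro ⟨y, t⟩ hp
      simp only [latticeBox, Fintype.mem_piFinset, Finset.mem_product] at hp
      have := hp.1 i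
      simp only [Finset.notMem_erase, if_false, Finset.mem_singleton] at this
      simp [← this]
    · intro x _
      have : x + Pi.single i 1 = Function.update x i (x i + 1) := by
        ext t
        by_cases ht : t = i
        · subst ht; simp
        · simp [ht]
      simp [this, CharTwo.sub_eq_add]
  rw [hbij, Finset.sum_product]
  refine Finset.sum_congr rfl fun y hy => ?_
  rw [Finset.sum_range_sub (fun t => g (Function.update y i t)), CharTwo.sub_eq_add]
  have := Fintype.mem_piFinset.1 hy i
  simp only [Finset.notMem_erase, if_false, Finset.mem_singleton] at this
  rw [← this, Function.update_eq_self]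

theorem sum_latticeBox_cupCoeff {ι : Type*} [Fintype ι] [DecidableEq ι] (M : ℕ)
    (a : ι → (ι → ℕ) → ZMod 2) (h₀ : ∀ j x, x j = 0 → a j x = 0)
    (h₁ : ∀ j x, x j = M → a j x = 1) (l : List ι) (hl : l.Nodup) :
    ∑ x ∈ latticeBox M l.toFinset, cupCoeff a l l.toFinset x = 1 := by
  induction l with
  | nil => simp [cupCoeff, latticeBox, Fintype.piFinset_singleton (fun _ : ι => M)]
  | cons j l ih =>
    have hjl := (List.nodup_cons.1 hl).1
    set A := (j :: l).toFinset with hA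
    have hAj : A.erase j = l.toFinset := by
      rw [hA, List.toFinset_cons, Finset.erase_insert (by simpa using hjl)]
    have hform : ∀ x, cupCoeff a (j :: l) A x = ∑ i ∈ A,
        (a j (x + Pi.single i 1) * cupCoeff a l (A.erase i) (x + Pi.single i 1) +
          a j x * cupCoeff a l (A.erase i) x) := by
      intro x
      have h := cupCoeff_closed a l A x
      rw [Finset.sum_add_distrib, CharTwo.add_eq_zero] at h
      simp only [cupCoeff, add_mul, Finset.sum_add_distrib, ← Finset.mul_sum, h]
    simp_rw [hform]
    rw [Finset.sum_comm]
    have htel : ∀ i ∈ A, ∑ x ∈ latticeBox M A,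
        (a j (x + Pi.single i 1) * cupCoeff a l (A.erase i) (x + Pi.single i 1) +
          a j x * cupCoeff a l (A.erase i) x) = if i = j then 1 else 0 := by
      intro i hi
      rw [sum_latticeBox_telescope M A hi (fun x => a j x * cupCoeff a l (A.erase i) x)]
      split_ifs with hij
      · subst hij
        rw [← ih (List.nodup_cons.1 hl).2, ← hAj]
        refine Finset.sum_congr rfl fun y hy => ?_
        have hy' := Fintype.mem_piFinset.1 hy i
        simp only [Finset.notMem_erase, if_false, Finset.mem_singleton] at hy'
        rw [h₁ i y hy', h₀ i (Function.update y i 0) (by simp)]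
        ring
      · have hil : i ∈ l := by
          rw [hA, List.mem_toFinset, List.mem_cons] at hi
          exact hi.resolve_left hij
        refine Finset.sum_eq_zero fun y hy => ?_
        have hy' := Fintype.mem_piFinset.1 hy i
        simp only [Finset.notMem_erase, if_false, Finset.mem_singleton] at hy'
        rw [cupCoeff_eq_zero_of_const a (h₁ i) l hil _ (Finset.notMem_erase i A) y hy',
          cupCoeff_eq_zero_of_const a (h₀ i) l hil _ (Finset.notMem_erase i A)
            (Function.update y i 0) (by simp)]
        ring
    rw [Finset.sum_congr rfl htel, Finset.sum_ite_eq' A j, if_pos (by simp [hA])]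

/-- A discrete Poincaré–Miranda theorem. -/
theorem exists_unit_cube_forall_nonconst {ι : Type*} [Fintype ι] [DecidableEq ι] (M : ℕ)
    (a : ι → (ι → ℕ) → ZMod 2) (h₀ : ∀ j x, x j = 0 → a j x = 0)
    (h₁ : ∀ j x, x j = M → a j x = 1) :
    ∃ x : ι → ℕ, ∀ j, ∃ y z : ι → ℕ, (∀ i, x i ≤ y i ∧ y i ≤ x i + 1) ∧
      (∀ i, x i ≤ z i ∧ z i ≤ x i + 1) ∧ a j y ≠ a j z := by
  have hsum := sum_latticeBox_cupCoeff M a h₀ h₁ Finset.univ.toList (Finset.nodup_toList _)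
  obtain ⟨x, -, hx⟩ := Finset.exists_ne_zero_of_sum_ne_zero (hsum.trans_ne one_ne_zero)
  refine ⟨x, fun j => ?_⟩
  simpa using exists_ne_of_cupCoeff_ne_zero a _ _ x hx j (by simp)

theorem ScaleChain.cons {X : Type*} {d : X → X → ℝ} {s : ℝ} {U : Set X} {x y z : X} (hx : x ∈ U)
    (hxy : d x y < s) (h : ScaleChain d s U y z) : ScaleChain d s U x z := by
  obtain ⟨m, c, h₀, hm, hU, hd⟩ := h
  refine ⟨m + 1, fun t => Nat.casesOn t x c, rfl, hm, ?_, ?_⟩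
  · rintro (_ | t) ht
    · exact hx
    · exact hU t (by omega)
  · rintro (_ | t) ht
    · simpa [h₀] using hxy
    · exact hd t (by omega)

theorem ScaleChain.refl {X : Type*} {d : X → X → ℝ} {s : ℝ} {U : Set X} {x : X} (hx : x ∈ U) :
    ScaleChain d s U x x :=
  ⟨0, fun _ => x, rfl, rfl, fun _ _ => hx, fun _ h => absurd h (Nat.not_lt_zero _)⟩

/-- A Lebesgue covering theorem: too few sets cannot cover a coarsely embedded large cube while
having small components. -/
theorem cube_width_le_of_cover {X : Type*} {d : X → X → ℝ} (hsymm : ∀ x y, d x y = d y x)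
    (htri : ∀ x y z, d x z ≤ d x y + d y z) {ι : Type*} [Fintype ι] (f : (ι → ℕ) → X) {M : ℕ}
    (hM : 0 < M) {r L s D : ℝ}
    (hr : ∀ x y : ι → ℕ, (∀ i, x i ≤ y i ∧ y i ≤ x i + 1) → d (f x) (f y) ≤ r)
    (hL : ∀ (j : ι) (x y : ι → ℕ), x j = 0 → y j = M → L ≤ d (f x) (f y))
    (hs : 2 * r < s) {m : ℕ} (hm : m < Fintype.card ι) (U : Fin (m + 1) → Set X)
    (hcover : ∀ x, ∃ i, x ∈ U i) (hU : ∀ i x y, ScaleChain d s (U i) x y → d x y ≤ D) :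
    L ≤ 2 * r + D := by
  classical
  by_contra! hlt
  obtain ⟨e⟩ := Function.Embedding.nonempty_of_card_le (α := Fin (m + 1)) (β := ι)
    (by simpa using hm)
  have hg : Function.Surjective (Function.invFun e) :=
    Function.invFun_surjective e.injective
  set g := Function.invFun e
  let P : ι → (ι → ℕ) → Prop := fun j x => x j = M ∨ ∃ (u v : X) (y : ι → ℕ), y j = M ∧
    d (f x) u ≤ r ∧ d v (f y) ≤ r ∧ ScaleChain d s (U (g j)) u v
  have h₀ : ∀ j x, x j = 0 → ¬ P j x := by
    rintro j x hx (h | ⟨u, v, y, hy, hu, hv, huv⟩)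
    · omega
    · have h₁ := hL j x y hx hy
      have h₂ := hU _ _ _ huv
      linarith [htri (f x) u (f y), htri u v (f y)]
  obtain ⟨x, hx⟩ := exists_unit_cube_forall_nonconst M (fun j x => if P j x then 1 else 0)
    (fun j x hx => if_neg (h₀ j x hx)) (fun j x hx => if_pos (Or.inl hx))
  obtain ⟨i, hi⟩ := hcover (f x)
  obtain ⟨j, rfl⟩ := hg i
  obtain ⟨y, z, hy, hz, hyz⟩ := hx j
  have key : ∀ y z : ι → ℕ, (∀ i, x i ≤ y i ∧ y i ≤ x i + 1) →
      (∀ i, x i ≤ z i ∧ z i ≤ x i + 1) → P j y → P j z := by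
    intro y z hy hz hP
    have hzx : d (f z) (f x) ≤ r := hsymm _ _ ▸ hr x z hz
    have hxy := hr x y hy
    right
    rcases hP with h | ⟨u, v, y', hy', hu, hv, huv⟩
    · exact ⟨f x, f x, y, h, hzx, hxy, ScaleChain.refl hi⟩
    · exact ⟨f x, v, y', hy', hzx, hv, huv.cons hi (by linarith [htri (f x) (f y) u])⟩
  exact hyz (by simp only [propext ⟨key y z hy hz, key z y hz hy⟩])

/-- The weighted supremum norm on a direct sum of cyclic groups. -/
def boxNorm {I : Type*} [DecidableEq I] (w N : I → ℕ) (x : Π₀ i, ZMod (N i)) : ℕ :=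
  x.support.sup fun i => w i * (x i).valMinAbs.natAbs

section BoxNorm

variable {I : Type*} [DecidableEq I] {w N : I → ℕ}

theorem boxNorm_le_iff {x : Π₀ i, ZMod (N i)} {c : ℕ} :
    boxNorm w N x ≤ c ↔ ∀ i, w i * (x i).valMinAbs.natAbs ≤ c := by
  rw [boxNorm, Finset.sup_le_iff]
  refine ⟨fun h i => ?_, fun h i _ => h i⟩
  by_cases hi : x i = 0
  · simp [hi]
  · exact h i (DFinsupp.mem_support_iff.2 hi)

theorem le_boxNorm (x : Π₀ i, ZMod (N i)) (i : I) :
    w i * (x i).valMinAbs.natAbs ≤ boxNorm w N x :=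
  boxNorm_le_iff.1 le_rfl i

theorem boxNorm_neg (x : Π₀ i, ZMod (N i)) : boxNorm w N (-x) = boxNorm w N x := by
  refine eq_of_forall_ge_iff fun c => ?_
  simp only [boxNorm_le_iff, DFinsupp.neg_apply, ZMod.natAbs_valMinAbs_neg]

theorem boxNorm_add_le (x y : Π₀ i, ZMod (N i)) :
    boxNorm w N (x + y) ≤ boxNorm w N x + boxNorm w N y := by
  rw [boxNorm_le_iff]
  intro i
  calc w i * ((x + y) i).valMinAbs.natAbs
      ≤ w i * ((x i).valMinAbs.natAbs + (y i).valMinAbs.natAbs) := by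
        gcongr
        exact (ZMod.natAbs_valMinAbs_add_le _ _).trans (Int.natAbs_add_le _ _)
    _ ≤ _ := by rw [mul_add]; exact add_le_add (le_boxNorm x i) (le_boxNorm y i)

theorem boxNorm_eq_zero_iff (hw : ∀ i, 0 < w i) {x : Π₀ i, ZMod (N i)} :
    boxNorm w N x = 0 ↔ x = 0 := by
  rw [← Nat.le_zero, boxNorm_le_iff, DFinsupp.ext_iff]
  refine forall_congr' fun i => ?_
  simp [(hw i).ne']

theorem finite_boxNorm_le (hw : ∀ i, 0 < w i) (hfin : ∀ c, {i | w i ≤ c}.Finite) (c : ℕ) :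
    {x : Π₀ i, ZMod (N i) | boxNorm w N x ≤ c}.Finite := by
  have := (hfin c).to_subtype
  refine Set.Finite.of_finite_image (f := fun x (i : {i | w i ≤ c}) => (x i.1).valMinAbs)
    ((Set.Finite.pi (fun _ : {i | w i ≤ c} => Set.finite_Icc (-(c : ℤ)) c)).subset ?_) ?_
  · rintro _ ⟨x, hx, rfl⟩ i -
    have h := boxNorm_le_iff.1 hx i.1
    have h₂ : (x i.1).valMinAbs.natAbs ≤ c :=
      (Nat.le_mul_of_pos_left _ (hw i.1)).trans h
    simp only [Set.mem_Icc]
    omega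
  · intro x hx y hy hxy
    ext i
    by_cases hi : w i ≤ c
    · have := congrFun hxy ⟨i, hi⟩
      exact ZMod.valMinAbs_inj.1 this
    · have hzero : ∀ z : Π₀ i, ZMod (N i), boxNorm w N z ≤ c → z i = 0 := by
        intro z hz
        have h := boxNorm_le_iff.1 hz i
        by_contra hne
        have : 0 < (z i).valMinAbs.natAbs := by
          rwa [Int.natAbs_pos, Ne, ZMod.valMinAbs_eq_zero]
        exact hi ((Nat.le_mul_of_pos_right _ this).trans h)
      rw [hzero x hx, hzero y hy]

/-- The distance of the weighted supremum norm. -/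
def boxDist (w N : I → ℕ) (x y : Multiplicative (Π₀ i, ZMod (N i))) : ℝ :=
  boxNorm w N (x.toAdd - y.toAdd)

theorem boxDist_symm (x y : Multiplicative (Π₀ i, ZMod (N i))) :
    boxDist w N x y = boxDist w N y x := by
  rw [boxDist, boxDist, ← neg_sub, boxNorm_neg]

theorem boxDist_triangle (x y z : Multiplicative (Π₀ i, ZMod (N i))) :
    boxDist w N x z ≤ boxDist w N x y + boxDist w N y z := by
  have h := boxNorm_add_le (w := w) (x.toAdd - y.toAdd) (y.toAdd - z.toAdd)
  rw [sub_add_sub_cancel] at h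
  unfold boxDist
  exact_mod_cast h

theorem isPLIMetric_boxDist (hw : ∀ i, 0 < w i) (hfin : ∀ c, {i | w i ≤ c}.Finite) :
    IsPLIMetric (boxDist w N) := by
  refine ⟨fun x y => ?_, boxDist_symm, boxDist_triangle, fun g x y => ?_, fun K => ?_⟩
  · rw [boxDist, Nat.cast_eq_zero, boxNorm_eq_zero_iff hw, sub_eq_zero]
    exact Multiplicative.toAdd.injective.eq_iff
  · simp only [boxDist, toAdd_mul, add_sub_add_left_eq_sub]
  · refine ((finite_boxNorm_le (N := N) hw hfin ⌊K⌋₊).preimage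
      Multiplicative.toAdd.injective.injOn).subset fun g hg => ?_
    have hg' : (boxNorm w N g.toAdd : ℝ) ≤ K := by
      simpa [boxDist, boxNorm_neg] using hg
    exact Nat.le_floor hg'

/-- The embedding of a grid along the coordinates `e i`, with dilation `κ i`. -/
def gridMap (N : I → ℕ) {ι : Type*} [Fintype ι] (e : ι → I) (κ : ι → ℕ) (x : ι → ℕ) :
    Multiplicative (Π₀ i, ZMod (N i)) :=
  Multiplicative.ofAdd (∑ i, DFinsupp.single (e i) ((κ i * x i : ℕ) : ZMod (N (e i))))

theorem gridMap_apply {ι : Type*} [Fintype ι] {e : ι → I} (he : Function.Injective e)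
    (κ x : ι → ℕ) (i : ι) :
    (gridMap N e κ x).toAdd (e i) = ((κ i * x i : ℕ) : ZMod (N (e i))) := by
  rw [gridMap, toAdd_ofAdd, DFinsupp.finsetSum_apply, Finset.sum_eq_single i]
  · simp
  · intro j _ hj
    exact DFinsupp.single_eq_of_ne (fun h => hj (he h).symm)
  · simp

theorem gridMap_apply_of_notMem {ι : Type*} [Fintype ι] {e : ι → I} (κ x : ι → ℕ) {p : I}
    (hp : p ∉ Set.range e) : (gridMap N e κ x).toAdd p = 0 := by
  rw [gridMap, toAdd_ofAdd, DFinsupp.finsetSum_apply]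
  exact Finset.sum_eq_zero fun i _ =>
    DFinsupp.single_eq_of_ne (fun h => hp ⟨i, h.symm⟩)

theorem natAbs_valMinAbs_intCast_le (n : ℕ) (z : ℤ) :
    (z : ZMod n).valMinAbs.natAbs ≤ z.natAbs := by
  rcases n with _ | n
  · exact le_rfl
  · exact ZMod.natAbs_min_of_le_div_two (n + 1) _ z (by simp) (ZMod.natAbs_valMinAbs_le _)

theorem natAbs_valMinAbs_natCast_le (n a : ℕ) : (a : ZMod n).valMinAbs.natAbs ≤ a := by
  simpa using natAbs_valMinAbs_intCast_le n a

theorem natAbs_valMinAbs_natCast_eq {n a : ℕ} (h : n = 0 ∨ a ≤ n / 2) :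
    (a : ZMod n).valMinAbs.natAbs = a := by
  rcases h with rfl | h
  · exact Int.natAbs_natCast a
  · rw [ZMod.valMinAbs_natCast_of_le_half h, Int.natAbs_natCast]

theorem boxDist_gridMap_le {ι : Type*} [Fintype ι] {e : ι → I} (he : Function.Injective e)
    {κ : ι → ℕ} {R : ℕ} (hκ : ∀ i, w (e i) * κ i = R) {x y : ι → ℕ}
    (hxy : ∀ i, x i ≤ y i ∧ y i ≤ x i + 1) :
    boxDist w N (gridMap N e κ x) (gridMap N e κ y) ≤ R := by
  rw [boxDist_symm, boxDist, Nat.cast_le, boxNorm_le_iff]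
  intro p
  rw [DFinsupp.sub_apply]
  by_cases hp : p ∈ Set.range e
  · obtain ⟨i, rfl⟩ := hp
    rw [gridMap_apply he, gridMap_apply he, ← Nat.cast_sub (Nat.mul_le_mul_left _ (hxy i).1),
      ← Nat.mul_sub, ← hκ i]
    refine Nat.mul_le_mul_left _ ((natAbs_valMinAbs_natCast_le _ _).trans ?_)
    have : y i - x i ≤ 1 := by have := hxy i; omega
    simpa using Nat.mul_le_mul_left (κ i) this
  · simp [gridMap_apply_of_notMem κ _ hp]

theorem le_boxDist_gridMap {ι : Type*} [Fintype ι] {e : ι → I} (he : Function.Injective e)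
    {κ : ι → ℕ} {R M : ℕ} (hκ : ∀ i, w (e i) * κ i = R)
    (hN : ∀ i, N (e i) = 0 ∨ κ i * M ≤ N (e i) / 2) (i : ι) {x y : ι → ℕ} (hx : x i = 0)
    (hy : y i = M) : (R * M : ℝ) ≤ boxDist w N (gridMap N e κ x) (gridMap N e κ y) := by
  have h := le_boxNorm (w := w) ((gridMap N e κ y).toAdd - (gridMap N e κ x).toAdd) (e i)
  rw [DFinsupp.sub_apply, gridMap_apply he, gridMap_apply he, hx, hy, mul_zero, Nat.cast_zero,
    sub_zero, natAbs_valMinAbs_natCast_eq (hN i), ← mul_assoc, hκ i] at h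
  rw [boxDist_symm, boxDist]
  exact_mod_cast h

theorem mul_le_of_isControlFun_boxDist {m : ℕ} {D : ℝ → ℝ} (hD : IsControlFun (boxDist w N) m D)
    {ι : Type*} [Fintype ι] (hm : m < Fintype.card ι) {e : ι → I} (he : Function.Injective e)
    {κ : ι → ℕ} {R M : ℕ} (hM : 0 < M) (hκ : ∀ i, w (e i) * κ i = R)
    (hN : ∀ i, N (e i) = 0 ∨ κ i * M ≤ N (e i) / 2) :
    (R * M : ℝ) ≤ 2 * R + D (2 * R + 1) := by
  obtain ⟨U, hcover, hU⟩ := hD (2 * R + 1) (by positivity)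
  exact cube_width_le_of_cover boxDist_symm boxDist_triangle (gridMap N e κ) hM
    (fun x y hxy => boxDist_gridMap_le he hκ hxy)
    (fun j x y hx hy => le_boxDist_gridMap he hκ hN j hx hy) (by linarith) hm U hcover hU

theorem ediv_eq_ediv_of_emod_ge {L ℓ u v : ℤ} (hL : 0 < L) (hu : ℓ ≤ u % L) (hv : ℓ ≤ v % L)
    (huv : |v - u| < ℓ) : u / L = v / L := by
  have hu₁ := Int.emod_lt_of_pos u hL
  have hv₁ := Int.emod_lt_of_pos v hL
  have hu₂ := Int.mul_ediv_add_emod u L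
  have hv₂ := Int.mul_ediv_add_emod v L
  rw [abs_lt] at huv
  rcases lt_trichotomy (u / L) (v / L) with h | h | h
  · nlinarith [mul_le_mul_of_nonneg_left (Int.add_one_le_of_lt h) hL.le]
  · exact h
  · nlinarith [mul_le_mul_of_nonneg_left (Int.add_one_le_of_lt h) hL.le]

/-- The index, among `P` blocks of length `ℓ` repeated periodically, of the block of `x`. -/
def cyclicBlock (ℓ P : ℕ) {n : ℕ} (x : ZMod n) : ℤ :=
  x.valMinAbs % (ℓ * P : ℕ) / ℓ

theorem le_emod_of_cyclicBlock_ne {ℓ P n : ℕ} (hℓ : 0 < ℓ) (hn : ℓ * P ∣ n) {k : ℕ} (hk : k < P)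
    {z : ℤ} (hz : cyclicBlock ℓ P (z : ZMod n) ≠ k) : (ℓ : ℤ) ≤ (z - k * ℓ) % (ℓ * P : ℕ) := by
  have hL : (0 : ℤ) < (ℓ * P : ℕ) := by
    have : 0 < P := by omega
    positivity
  have hmod : (z : ZMod n).valMinAbs % (ℓ * P : ℕ) = z % (ℓ * P : ℕ) := by
    have h : ((z : ZMod n).valMinAbs : ZMod n) = z := ZMod.coe_valMinAbs _
    rw [ZMod.intCast_eq_intCast_iff_dvd_sub] at h
    exact Int.emod_eq_emod_iff_emod_sub_eq_zero.2 (Int.emod_eq_zero_of_dvd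
      ((Int.natCast_dvd_natCast.2 hn).trans ((dvd_sub_comm).1 h)))
  rw [cyclicBlock, hmod] at hz
  by_contra! hlt
  refine hz ?_
  have h₀ := Int.emod_nonneg (z - k * ℓ) hL.ne'
  have h₁ := Int.mul_ediv_add_emod (z - k * ℓ) (ℓ * P : ℕ)
  set v := (z - k * ℓ) % (ℓ * P : ℕ)
  set c := (z - k * ℓ) / (ℓ * P : ℕ)
  have hz' : z = (v + ℓ * k) + (ℓ * P : ℕ) * c := by linarith
  have hkP : (k : ℤ) + 1 ≤ P := by exact_mod_cast hk
  have hℓ' : (0 : ℤ) < ℓ := by exact_mod_cast hℓ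
  rw [hz', Int.add_mul_emod_self_left, Int.emod_eq_of_lt (by positivity) (by push_cast; nlinarith),
    Int.add_mul_ediv_left _ _ hℓ'.ne', Int.ediv_eq_zero_of_lt h₀ hlt, zero_add]

theorem natAbs_valMinAbs_sub_le_of_chain {ℓ P n : ℕ} (hℓ : 0 < ℓ) (hn : ℓ * P ∣ n) {k : ℕ}
    (hk : k < P) {m : ℕ} {c : ℕ → ZMod n} (hc : ∀ t ≤ m, cyclicBlock ℓ P (c t) ≠ k)
    (hstep : ∀ t < m, (c (t + 1) - c t).valMinAbs.natAbs < ℓ) :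
    (c m - c 0).valMinAbs.natAbs ≤ ℓ * P := by
  have hL : (0 : ℤ) < (ℓ * P : ℕ) := by
    have : 0 < P := by omega
    positivity
  set z₀ := (c 0).valMinAbs
  have key : ∀ t ≤ m, ∃ z : ℤ, (z : ZMod n) = c t ∧
      (z - k * ℓ) / (ℓ * P : ℕ) = (z₀ - k * ℓ) / (ℓ * P : ℕ) := by
    intro t
    induction t with
    | zero => exact fun _ => ⟨z₀, ZMod.coe_valMinAbs _, rfl⟩
    | succ t ih =>
      intro ht
      obtain ⟨z, hz, hdiv⟩ := ih (by omega)
      have hz' : ((z + (c (t + 1) - c t).valMinAbs : ℤ) : ZMod n) = c (t + 1) := by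
        rw [Int.cast_add, ZMod.coe_valMinAbs, hz, add_sub_cancel]
      refine ⟨_, hz', ?_⟩
      rw [← hdiv]
      refine (ediv_eq_ediv_of_emod_ge hL
        (le_emod_of_cyclicBlock_ne hℓ hn hk (by rw [hz]; exact hc t (by omega)))
        (le_emod_of_cyclicBlock_ne hℓ hn hk (by rw [hz']; exact hc _ ht)) ?_).symm
      have := hstep t (by omega)
      rw [show ∀ a b c : ℤ, a + b - c - (a - c) = b by intros; ring, Int.abs_eq_natAbs]
      exact_mod_cast this
  obtain ⟨z, hz, hdiv⟩ := key m le_rfl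
  have hcast : c m - c 0 = ((z - z₀ : ℤ) : ZMod n) := by
    rw [Int.cast_sub, hz, ZMod.coe_valMinAbs]
  rw [hcast]
  refine (natAbs_valMinAbs_intCast_le n _).trans ?_
  have h₁ := Int.mul_ediv_add_emod (z - k * ℓ) (ℓ * P : ℕ)
  have h₂ := Int.mul_ediv_add_emod (z₀ - k * ℓ) (ℓ * P : ℕ)
  have h₃ := Int.emod_lt_of_pos (z - k * ℓ) hL
  have h₄ := Int.emod_lt_of_pos (z₀ - k * ℓ) hL
  have h₅ := Int.emod_nonneg (z - k * ℓ) hL.ne'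
  have h₆ := Int.emod_nonneg (z₀ - k * ℓ) hL.ne'
  rw [hdiv] at h₁
  zify
  rw [abs_le]
  push_cast at *
  constructor <;> linarith

theorem exists_cover_boxDist {S P B m : ℕ} (hS : 0 < S) (F : Finset I) (hF : F.card ≤ m)
    (hm : m < P) (hout : ∀ i ∉ F, S ≤ w i ∨ 0 < N i ∧ w i * N i ≤ B)
    (hin : ∀ i ∈ F, ∃ ℓ, w i * ℓ = S ∧ ℓ * P ∣ N i) (hB : S * P ≤ B) {s : ℝ} (hs : s ≤ S) :
    ∃ U : Fin (m + 1) → Set (Multiplicative (Π₀ i, ZMod (N i))),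
      (∀ x, ∃ c, x ∈ U c) ∧
        ∀ c x y, ScaleChain (boxDist w N) s (U c) x y → boxDist w N x y ≤ B := by
  choose! ℓ hℓ hdvd using hin
  refine ⟨fun c => {x | ∀ i ∈ F, cyclicBlock (ℓ i) P (x.toAdd i) ≠ (c : ℕ)}, fun x => ?_, ?_⟩
  · obtain ⟨_, hc, hc'⟩ := Finset.exists_mem_notMem_of_card_lt_card
      (s := F.image fun i => cyclicBlock (ℓ i) P (x.toAdd i))
      (t := Finset.univ.image fun c : Fin (m + 1) => ((c : ℕ) : ℤ)) (by
        rw [Finset.card_image_of_injective _ (fun a b h => Fin.ext (by exact_mod_cast h)),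
          Finset.card_univ, Fintype.card_fin]
        exact Nat.lt_succ_of_le (Finset.card_image_le.trans hF))
    obtain ⟨c, -, rfl⟩ := Finset.mem_image.1 hc
    exact ⟨c, fun i hi h => hc' (Finset.mem_image.2 ⟨i, hi, h⟩)⟩
  · rintro k x y ⟨r, c, rfl, rfl, hU, hd⟩
    have hstep : ∀ t < r, ∀ i,
        w i * ((c (t + 1)).toAdd i - (c t).toAdd i).valMinAbs.natAbs < S := by
      intro t ht i
      have h := (hd t ht).trans_le hs
      rw [boxDist_symm, boxDist, Nat.cast_lt] at h
      exact (le_boxNorm _ i).trans_lt h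
    rw [boxDist_symm, boxDist, Nat.cast_le, boxNorm_le_iff]
    intro i
    rw [DFinsupp.sub_apply]
    by_cases hi : i ∈ F
    · have hpos : 0 < w i * ℓ i := (hℓ i hi).symm ▸ hS
      have h := natAbs_valMinAbs_sub_le_of_chain (k := k) (Nat.pos_of_mul_pos_left hpos)
        (hdvd i hi) (by omega) (c := fun t => (c t).toAdd i) (m := r)
        (fun t ht => hU t ht i hi)
        (fun t ht => Nat.lt_of_mul_lt_mul_left ((hstep t ht i).trans_eq (hℓ i hi).symm))
      calc _ ≤ w i * (ℓ i * P) := Nat.mul_le_mul_left _ h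
        _ ≤ B := by rwa [← mul_assoc, hℓ i hi]
    · rcases hout i hi with hw | ⟨hN, hB⟩
      · have hconst : ∀ t ≤ r, (c t).toAdd i = (c 0).toAdd i := by
          intro t
          induction t with
          | zero => exact fun _ => rfl
          | succ t ih =>
            intro ht
            rw [← ih (by omega), ← sub_eq_zero, ← ZMod.valMinAbs_eq_zero, ← Int.natAbs_eq_zero]
            by_contra hne
            exact absurd (hstep t (by omega) i) (not_lt.2 (hw.trans
              (Nat.le_mul_of_pos_right _ (Nat.pos_of_ne_zero hne))))
        simp [hconst r le_rfl]
      · have : NeZero (N i) := ⟨hN.ne'⟩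
        refine (Nat.mul_le_mul_left _ ((ZMod.natAbs_valMinAbs_le _).trans ?_)).trans hB
        exact Nat.div_le_self _ _

end BoxNorm

/-- The weights of the generators: `1` on the free part and `2 ^ (j ^ 2)` on the `j`-th block of
the torsion part. -/
def towerWeight (n k : ℕ) : Fin n ⊕ ℕ × Fin k → ℕ :=
  Sum.elim (fun _ => 1) fun p => 2 ^ (p.1 ^ 2)

/-- The orders of the generators: infinite, written `0`, on the free part and `2 ^ (2 * j + 1)` on
the `j`-th block of the torsion part. -/
def towerOrder (n k : ℕ) : Fin n ⊕ ℕ × Fin k → ℕ :=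
  Sum.elim (fun _ => 0) fun p => 2 ^ (2 * p.1 + 1)

theorem towerWeight_pos (n k : ℕ) (i : Fin n ⊕ ℕ × Fin k) : 0 < towerWeight n k i := by
  rcases i with i | p <;> simp [towerWeight]

theorem finite_towerWeight_le (n k c : ℕ) : {i | towerWeight n k i ≤ c}.Finite := by
  refine ((Finset.univ : Finset (Fin n)).disjSum
    (Finset.Iic c ×ˢ (Finset.univ : Finset (Fin k)))).finite_toSet.subset ?_
  rintro (i | ⟨j, t⟩) hi
  · simp
  · have h : 2 ^ (j ^ 2) ≤ c := hi
    have : j ≤ c := (Nat.le_self_pow two_ne_zero j).trans (Nat.lt_two_pow_self.le.trans h)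
    simpa using this

theorem exists_cover_tower {n k q p B m : ℕ} (T : Finset ℕ)
    (hT : ∀ j ∈ T, j ^ 2 ≤ q ∧ q + p ≤ (j + 1) ^ 2)
    (hT' : ∀ j ∉ T, q ≤ j ^ 2 ∨ 2 ^ ((j + 1) ^ 2) ≤ B) (hcard : n + T.card * k ≤ m)
    (hm : m < 2 ^ p) (hB : 2 ^ q * 2 ^ p ≤ B) {s : ℝ} (hs : s ≤ 2 ^ q) :
    ∃ U : Fin (m + 1) → Set (Multiplicative (Π₀ i, ZMod (towerOrder n k i))),
      (∀ x, ∃ c, x ∈ U c) ∧ ∀ c x y,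
        ScaleChain (boxDist (towerWeight n k) (towerOrder n k)) s (U c) x y →
          boxDist (towerWeight n k) (towerOrder n k) x y ≤ B := by
  refine exists_cover_boxDist (S := 2 ^ q) (P := 2 ^ p) (by positivity)
    (Finset.univ.disjSum (T ×ˢ Finset.univ)) (by simpa using hcard) hm ?_ ?_ hB
    (by exact_mod_cast hs)
  · rintro (i | ⟨j, t⟩) hi
    · simp at hi
    · have hj : j ∉ T := by simpa using hi
      refine (hT' j hj).imp (fun h => Nat.pow_le_pow_right two_pos h) fun h =>
        ⟨by simp [towerOrder], ?_⟩
      calc 2 ^ (j ^ 2) * 2 ^ (2 * j + 1) = 2 ^ ((j + 1) ^ 2) := by rw [← pow_add]; ring_nf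
        _ ≤ B := h
  · rintro (i | ⟨j, t⟩) hi
    · exact ⟨2 ^ q, one_mul _, dvd_zero _⟩
    · obtain ⟨h₁, h₂⟩ := hT j (by simpa using hi)
      refine ⟨2 ^ (q - j ^ 2), ?_, ?_⟩
      · change 2 ^ (j ^ 2) * _ = _
        rw [← pow_add]
        congr 1
        omega
      · change _ ∣ 2 ^ (2 * j + 1)
        rw [← pow_add]
        refine pow_dvd_pow 2 ?_
        have : (j + 1) ^ 2 = j ^ 2 + (2 * j + 1) := by ring
        omega

theorem asdimLE_tower (n k : ℕ) : AsdimLE (boxDist (towerWeight n k) (towerOrder n k)) n := by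
  refine ⟨fun s => (2 ^ ((⌈s⌉₊ + 1) ^ 2) + 2 ^ ⌈s⌉₊ * 2 ^ n : ℕ), fun s _ => ?_⟩
  refine exists_cover_tower (q := ⌈s⌉₊) (p := n) ∅ (by simp) (fun j _ => ?_) (by simp)
    Nat.lt_two_pow_self (Nat.le_add_left _ _) ?_
  · rcases le_or_gt ⌈s⌉₊ (j ^ 2) with h | h
    · exact Or.inl h
    · have : j ≤ ⌈s⌉₊ := (Nat.le_self_pow two_ne_zero j).trans h.le
      refine Or.inr (le_add_right ?_)
      gcongr
      norm_num
  · exact (Nat.le_ceil s).trans (by exact_mod_cast Nat.lt_two_pow_self.le)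

theorem anDimLE_tower (n k : ℕ) :
    ANdimLE (boxDist (towerWeight n k) (towerOrder n k)) (n + k) := by
  refine ⟨2 * 2 ^ (n + k), by positivity, 2 * 2 ^ (n + k), fun s hs => ?_⟩
  obtain ⟨r, hr, hsr⟩ := exists_nat_pow_near (x := s + 1) (y := (2 : ℝ)) (by linarith) (by norm_num)
  set q := r + 1
  have hq : (2 : ℝ) ^ q ≤ 2 * (s + 1) := by
    rw [pow_succ]
    linarith
  obtain ⟨T, hcard, hT, hT'⟩ : ∃ T : Finset ℕ, T.card ≤ 1 ∧
      (∀ j ∈ T, j ^ 2 ≤ q ∧ q + (n + k) ≤ (j + 1) ^ 2) ∧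
      ∀ j ∉ T, q ≤ j ^ 2 ∨ (j + 1) ^ 2 ≤ q + (n + k) := by
    by_cases h : ∃ i, i ^ 2 < q ∧ q + (n + k) < (i + 1) ^ 2
    · obtain ⟨i, h₁, h₂⟩ := h
      refine ⟨{i}, by simp, fun j hj => ?_, fun j hj => ?_⟩
      · rw [Finset.mem_singleton.1 hj]
        exact ⟨h₁.le, h₂.le⟩
      · rcases lt_or_gt_of_ne (Finset.mem_singleton.not.1 hj) with hlt | hlt
        · have := Nat.pow_le_pow_left (Nat.succ_le_of_lt hlt) 2
          exact Or.inr (by simp only [Nat.succ_eq_add_one] at this; omega)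
        · have := Nat.pow_le_pow_left (Nat.succ_le_of_lt hlt) 2
          exact Or.inl (by simp only [Nat.succ_eq_add_one] at this; omega)
    · push Not at h
      exact ⟨∅, by simp, by simp, fun j _ => (le_or_gt q (j ^ 2)).imp_right (h j)⟩
  obtain ⟨U, hcover, hU⟩ := exists_cover_tower (B := 2 ^ q * 2 ^ (n + k)) (m := n + k) (s := s)
    T hT (fun j hj => (hT' j hj).imp_right fun h => by
      rw [← pow_add]
      exact Nat.pow_le_pow_right two_pos h)
    (Nat.add_le_add_left (by simpa using Nat.mul_le_mul_right k hcard) n)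
    Nat.lt_two_pow_self le_rfl (by linarith)
  refine ⟨U, hcover, fun c x y h => (hU c x y h).trans ?_⟩
  push_cast
  nlinarith [mul_le_mul_of_nonneg_right hq (by positivity : (0 : ℝ) ≤ 2 ^ (n + k))]

theorem not_asdimLE_tower {n k m : ℕ} (hm : m < n) :
    ¬ AsdimLE (boxDist (towerWeight n k) (towerOrder n k)) m := by
  rintro ⟨D, hD⟩
  obtain ⟨M, hM⟩ := exists_nat_gt (max 0 (2 + D 3))
  have h := mul_le_of_isControlFun_boxDist hD (ι := Fin n) (by simpa using hm)
    (e := Sum.inl) Sum.inl_injective (κ := fun _ => 1) (R := 1) (M := M)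
    (by exact_mod_cast (le_max_left _ _).trans_lt hM) (fun _ => rfl) (fun _ => Or.inl rfl)
  norm_num at h
  linarith [(le_max_right _ _).trans_lt hM]

theorem not_anDimLE_tower {n k m : ℕ} (hm : m < n + k) :
    ¬ ANdimLE (boxDist (towerWeight n k) (towerOrder n k)) m := by
  rintro ⟨C, hC, b, hD⟩
  obtain ⟨j, hj⟩ := exists_nat_gt (2 + 3 * C + |b|)
  have hjM : (j : ℝ) ≤ (2 ^ (2 * j) : ℕ) := by
    exact_mod_cast Nat.lt_two_pow_self.le.trans (Nat.pow_le_pow_right two_pos (by omega))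
  have hR : (1 : ℝ) ≤ (2 ^ (j ^ 2) : ℕ) := by exact_mod_cast Nat.one_le_two_pow
  have h := mul_le_of_isControlFun_boxDist hD (ι := Fin n ⊕ Fin k) (by simpa using hm)
    (e := Sum.map id fun t => (j, t))
    (Sum.map_injective.2 ⟨Function.injective_id, Prod.mk_right_injective j⟩)
    (κ := Sum.elim (fun _ => 2 ^ (j ^ 2)) fun _ => 1) (R := 2 ^ (j ^ 2)) (M := 2 ^ (2 * j))
    (by positivity)
    (by rintro (i | i) <;> simp [towerWeight])
    (by
      rintro (i | i)
      · exact Or.inl rfl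
      · right
        simp [towerOrder, pow_succ])
  generalize ((2 ^ (j ^ 2) : ℕ) : ℝ) = R at h hR
  generalize ((2 ^ (2 * j) : ℕ) : ℝ) = M at h hjM
  have hb : b ≤ R * |b| := (le_abs_self b).trans (le_mul_of_one_le_left (abs_nonneg b) hR)
  have hCR : C ≤ R * C := le_mul_of_one_le_left hC.le hR
  nlinarith [mul_lt_mul_of_pos_left (hj.trans_le hjM) (zero_lt_one.trans_le hR)]

/-- For every `n, k` there is a countable abelian group with a proper left invariant
metric of asymptotic dimension exactly `n` and asymptotic Assouad-Nagata dimension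
exactly `n + k`. -/
theorem exists_countable_abelian_group_asdim_lt_asdimAN (n k : ℕ) :
    ∃ (G : Type) (inst : CommGroup G) (d : G → G → ℝ),
      Countable G ∧ @IsPLIMetric G (@CommGroup.toGroup G inst) d ∧
        AsdimLE d n ∧ (∀ m : ℕ, m < n → ¬ AsdimLE d m) ∧
        ANdimLE d (n + k) ∧ (∀ m : ℕ, m < n + k → ¬ ANdimLE d m) := by
  have : ∀ i, Countable (ZMod (towerOrder n k i)) := fun _ =>
    ZMod.injective_valMinAbs.countable
  exact ⟨Multiplicative (Π₀ i, ZMod (towerOrder n k i)), inferInstance,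
    boxDist (towerWeight n k) (towerOrder n k), Multiplicative.toAdd.injective.countable,
    isPLIMetric_boxDist (towerWeight_pos n k) (finite_towerWeight_le n k),
    asdimLE_tower n k, fun _ => not_asdimLE_tower, anDimLE_tower n k, fun _ => not_anDimLE_tower⟩
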